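/- Let u : ℝ³ → ℝ be a smooth function of (x, y, t) satisfying the rdDym equation u_ty = u_x u_xy − u_y u_xx at every point, and let T : ℝ → ℝ and Y : ℝ → ℝ be arbitrary smooth functions (of t and y respectively). Then each of the five functions ψ₀ = −x u_x + 2u, υ₀(Y) = Y(y) u_y, θ₀(T) = T(t) u_t + T'(t)(x u_x − u) + ½ T''(t) x², θ₋₁(T) = T(t) u_x + T'(t) x, and θ₋₂(T) = T(t) satisfies the linearized rdDym equation ℓ_E(φ) := φ_ty − u_x φ_xy + u_y φ_xx − u_xy φ_x + u_xx φ_y = 0 at every point of ℝ³. (These functions are generating functions of local symmetries of the rdDym equation.) -/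

import Mathlib

noncomputable section

/-- Partial derivative with respect to the first variable (`x`). -/
def Dx (f : ℝ → ℝ → ℝ → ℝ) (x y t : ℝ) : ℝ := deriv (fun x' => f x' y t) x

/-- Partial derivative with respect to the second variable (`y`). -/
def Dy (f : ℝ → ℝ → ℝ → ℝ) (x y t : ℝ) : ℝ := deriv (fun y' => f x y' t) y

/-- Partial derivative with respect to the third variable (`t`). -/
def Dt (f : ℝ → ℝ → ℝ → ℝ) (x y t : ℝ) : ℝ := deriv (fun t' => f x y t') t

/-- Smoothness of a function of three real variables `(x, y, t)`. -/
def Smooth3 (f : ℝ → ℝ → ℝ → ℝ) : Prop :=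
  ContDiff ℝ (⊤ : ℕ∞) (fun p : ℝ × ℝ × ℝ => f p.1 p.2.1 p.2.2)

/-- Linearization of the rdDym equation `u_ty = u_x u_xy - u_y u_xx` at a solution `u`. -/
def linRdDym (u φ : ℝ → ℝ → ℝ → ℝ) (x y t : ℝ) : ℝ :=
  Dt (Dy φ) x y t - Dx u x y t * Dx (Dy φ) x y t + Dy u x y t * Dx (Dx φ) x y t
    - Dx (Dy u) x y t * Dx φ x y t + Dx (Dx u) x y t * Dy φ x y t

/-- Differentiation of a composition with a curve `c` of constant velocity `e`. -/
theorem Smooth3.hasDerivAt_comp {f : ℝ → ℝ → ℝ → ℝ} (hf : Smooth3 f) {c : ℝ → ℝ × ℝ × ℝ}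
    {e : ℝ × ℝ × ℝ} {s : ℝ} (hc : HasDerivAt c e s) :
    HasDerivAt (fun r => f (c r).1 (c r).2.1 (c r).2.2)
      (fderiv ℝ (fun p : ℝ × ℝ × ℝ => f p.1 p.2.1 p.2.2) (c s) e) s :=
  ((ContDiff.differentiable hf (by simp)) (c s)).hasFDerivAt.comp_hasDerivAt s hc

theorem hasDerivAt_curve_x (x y t : ℝ) :
    HasDerivAt (fun r : ℝ => ((r, y, t) : ℝ × ℝ × ℝ)) (1, 0, 0) x :=
  (hasDerivAt_id x).prodMk ((hasDerivAt_const x y).prodMk (hasDerivAt_const x t))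

theorem hasDerivAt_curve_y (x y t : ℝ) :
    HasDerivAt (fun r : ℝ => ((x, r, t) : ℝ × ℝ × ℝ)) (0, 1, 0) y :=
  (hasDerivAt_const y x).prodMk ((hasDerivAt_id y).prodMk (hasDerivAt_const y t))

theorem hasDerivAt_curve_t (x y t : ℝ) :
    HasDerivAt (fun r : ℝ => ((x, y, r) : ℝ × ℝ × ℝ)) (0, 0, 1) t :=
  (hasDerivAt_const t x).prodMk ((hasDerivAt_const t y).prodMk (hasDerivAt_id t))

theorem Smooth3.Dx_eq_fderiv {f : ℝ → ℝ → ℝ → ℝ} (hf : Smooth3 f) (x y t : ℝ) :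
    Dx f x y t = fderiv ℝ (fun p : ℝ × ℝ × ℝ => f p.1 p.2.1 p.2.2) (x, y, t) (1, 0, 0) :=
  (hf.hasDerivAt_comp (hasDerivAt_curve_x x y t)).deriv

theorem Smooth3.hasDerivAt_x {f : ℝ → ℝ → ℝ → ℝ} (hf : Smooth3 f) (x y t : ℝ) :
    HasDerivAt (fun r => f r y t) (Dx f x y t) x := by
  rw [hf.Dx_eq_fderiv]
  exact hf.hasDerivAt_comp (hasDerivAt_curve_x x y t)

theorem Smooth3.Dy_eq_fderiv {f : ℝ → ℝ → ℝ → ℝ} (hf : Smooth3 f) (x y t : ℝ) :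
    Dy f x y t = fderiv ℝ (fun p : ℝ × ℝ × ℝ => f p.1 p.2.1 p.2.2) (x, y, t) (0, 1, 0) :=
  (hf.hasDerivAt_comp (hasDerivAt_curve_y x y t)).deriv

theorem Smooth3.hasDerivAt_y {f : ℝ → ℝ → ℝ → ℝ} (hf : Smooth3 f) (x y t : ℝ) :
    HasDerivAt (fun r => f x r t) (Dy f x y t) y := by
  rw [hf.Dy_eq_fderiv]
  exact hf.hasDerivAt_comp (hasDerivAt_curve_y x y t)

theorem Smooth3.Dt_eq_fderiv {f : ℝ → ℝ → ℝ → ℝ} (hf : Smooth3 f) (x y t : ℝ) :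
    Dt f x y t = fderiv ℝ (fun p : ℝ × ℝ × ℝ => f p.1 p.2.1 p.2.2) (x, y, t) (0, 0, 1) :=
  (hf.hasDerivAt_comp (hasDerivAt_curve_t x y t)).deriv

theorem Smooth3.hasDerivAt_t {f : ℝ → ℝ → ℝ → ℝ} (hf : Smooth3 f) (x y t : ℝ) :
    HasDerivAt (fun r => f x y r) (Dt f x y t) t := by
  rw [hf.Dt_eq_fderiv]
  exact hf.hasDerivAt_comp (hasDerivAt_curve_t x y t)

theorem Smooth3.fderiv_apply {f : ℝ → ℝ → ℝ → ℝ} (hf : Smooth3 f) (e : ℝ × ℝ × ℝ) :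
    Smooth3 (fun x y t => fderiv ℝ (fun p : ℝ × ℝ × ℝ => f p.1 p.2.1 p.2.2) (x, y, t) e) :=
  (ContDiff.fderiv_right (m := (⊤ : ℕ∞)) hf (by simp)).clm_apply contDiff_const

/-- Symmetry of second derivatives. -/
theorem Smooth3.fderiv_fderiv_comm {f : ℝ → ℝ → ℝ → ℝ} (hf : Smooth3 f)
    (p e e' : ℝ × ℝ × ℝ) :
    fderiv ℝ (fun q => fderiv ℝ (fun p : ℝ × ℝ × ℝ => f p.1 p.2.1 p.2.2) q e) p e' =
      fderiv ℝ (fun q => fderiv ℝ (fun p : ℝ × ℝ × ℝ => f p.1 p.2.1 p.2.2) q e') p e := by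
  have hd : DifferentiableAt ℝ (fderiv ℝ (fun p : ℝ × ℝ × ℝ => f p.1 p.2.1 p.2.2)) p :=
    (ContDiff.fderiv_right (m := (⊤ : ℕ∞)) hf (by simp)).differentiable (by simp) p
  have hs : IsSymmSndFDerivAt ℝ (fun p : ℝ × ℝ × ℝ => f p.1 p.2.1 p.2.2) p :=
    (ContDiff.contDiffAt hf).isSymmSndFDerivAt
      (by simpa using WithTop.coe_le_coe.2 (le_top : (2 : ℕ∞) ≤ ⊤))
  rw [fderiv_clm_apply hd (by fun_prop), fderiv_clm_apply hd (by fun_prop)]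
  simpa using hs e' e

theorem Smooth3.Dx_eq {f : ℝ → ℝ → ℝ → ℝ} (hf : Smooth3 f) :
    Dx f = fun x y t =>
      fderiv ℝ (fun p : ℝ × ℝ × ℝ => f p.1 p.2.1 p.2.2) (x, y, t) (1, 0, 0) := by
  funext x y t
  exact hf.Dx_eq_fderiv x y t

theorem Smooth3.Dx {f : ℝ → ℝ → ℝ → ℝ} (hf : Smooth3 f) : Smooth3 (_root_.Dx f) :=
  hf.Dx_eq ▸ hf.fderiv_apply _

theorem Smooth3.Dy_eq {f : ℝ → ℝ → ℝ → ℝ} (hf : Smooth3 f) :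
    Dy f = fun x y t =>
      fderiv ℝ (fun p : ℝ × ℝ × ℝ => f p.1 p.2.1 p.2.2) (x, y, t) (0, 1, 0) := by
  funext x y t
  exact hf.Dy_eq_fderiv x y t

theorem Smooth3.Dy {f : ℝ → ℝ → ℝ → ℝ} (hf : Smooth3 f) : Smooth3 (_root_.Dy f) :=
  hf.Dy_eq ▸ hf.fderiv_apply _

theorem Smooth3.Dt_eq {f : ℝ → ℝ → ℝ → ℝ} (hf : Smooth3 f) :
    Dt f = fun x y t =>
      fderiv ℝ (fun p : ℝ × ℝ × ℝ => f p.1 p.2.1 p.2.2) (x, y, t) (0, 0, 1) := by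
  funext x y t
  exact hf.Dt_eq_fderiv x y t

theorem Smooth3.Dt {f : ℝ → ℝ → ℝ → ℝ} (hf : Smooth3 f) : Smooth3 (_root_.Dt f) :=
  hf.Dt_eq ▸ hf.fderiv_apply _

theorem Smooth3.Dy_Dx {f : ℝ → ℝ → ℝ → ℝ} (hf : Smooth3 f) :
    _root_.Dy (_root_.Dx f) = _root_.Dx (_root_.Dy f) := by
  funext x y t
  rw [hf.Dx.Dy_eq_fderiv, hf.Dy.Dx_eq_fderiv, hf.Dx_eq, hf.Dy_eq]
  exact hf.fderiv_fderiv_comm (x, y, t) _ _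

theorem Smooth3.Dt_Dx {f : ℝ → ℝ → ℝ → ℝ} (hf : Smooth3 f) :
    _root_.Dt (_root_.Dx f) = _root_.Dx (_root_.Dt f) := by
  funext x y t
  rw [hf.Dx.Dt_eq_fderiv, hf.Dt.Dx_eq_fderiv, hf.Dx_eq, hf.Dt_eq]
  exact hf.fderiv_fderiv_comm (x, y, t) _ _

theorem Smooth3.Dt_Dy {f : ℝ → ℝ → ℝ → ℝ} (hf : Smooth3 f) :
    _root_.Dt (_root_.Dy f) = _root_.Dy (_root_.Dt f) := by
  funext x y t
  rw [hf.Dy.Dt_eq_fderiv, hf.Dt.Dy_eq_fderiv, hf.Dy_eq, hf.Dt_eq]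
  exact hf.fderiv_fderiv_comm (x, y, t) _ _

/-- The rdDym equation differentiated with respect to `x`. -/
theorem rdDym_Dx {u : ℝ → ℝ → ℝ → ℝ} (hu : Smooth3 u)
    (husol : ∀ x y t : ℝ,
      Dt (Dy u) x y t = Dx u x y t * Dx (Dy u) x y t - Dy u x y t * Dx (Dx u) x y t) (x y t : ℝ) :
    Dx (Dt (Dy u)) x y t =
      Dx (Dx u) x y t * Dx (Dy u) x y t + Dx u x y t * Dx (Dx (Dy u)) x y t
        - (Dx (Dy u) x y t * Dx (Dx u) x y t + Dy u x y t * Dx (Dx (Dx u)) x y t) := by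
  have h : Dt (Dy u) = fun x y t =>
      Dx u x y t * Dx (Dy u) x y t - Dy u x y t * Dx (Dx u) x y t := by
    funext x y t
    exact husol x y t
  exact (congrArg (fun f => Dx f x y t) h).trans
    (((hu.Dx.hasDerivAt_x x y t).mul (hu.Dy.Dx.hasDerivAt_x x y t)).sub
    ((hu.Dy.hasDerivAt_x x y t).mul (hu.Dx.Dx.hasDerivAt_x x y t))).deriv

/-- The rdDym equation differentiated with respect to `y`. -/
theorem rdDym_Dy {u : ℝ → ℝ → ℝ → ℝ} (hu : Smooth3 u)
    (husol : ∀ x y t : ℝ,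
      Dt (Dy u) x y t = Dx u x y t * Dx (Dy u) x y t - Dy u x y t * Dx (Dx u) x y t) (x y t : ℝ) :
    Dy (Dt (Dy u)) x y t =
      Dy (Dx u) x y t * Dx (Dy u) x y t + Dx u x y t * Dy (Dx (Dy u)) x y t
        - (Dy (Dy u) x y t * Dx (Dx u) x y t + Dy u x y t * Dy (Dx (Dx u)) x y t) := by
  have h : Dt (Dy u) = fun x y t =>
      Dx u x y t * Dx (Dy u) x y t - Dy u x y t * Dx (Dx u) x y t := by
    funext x y t
    exact husol x y t
  exact (congrArg (fun f => Dy f x y t) h).trans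
    (((hu.Dx.hasDerivAt_y x y t).mul (hu.Dy.Dx.hasDerivAt_y x y t)).sub
    ((hu.Dy.hasDerivAt_y x y t).mul (hu.Dx.Dx.hasDerivAt_y x y t))).deriv

/-- The rdDym equation differentiated with respect to `t`. -/
theorem rdDym_Dt {u : ℝ → ℝ → ℝ → ℝ} (hu : Smooth3 u)
    (husol : ∀ x y t : ℝ,
      Dt (Dy u) x y t = Dx u x y t * Dx (Dy u) x y t - Dy u x y t * Dx (Dx u) x y t) (x y t : ℝ) :
    Dt (Dt (Dy u)) x y t =
      Dt (Dx u) x y t * Dx (Dy u) x y t + Dx u x y t * Dt (Dx (Dy u)) x y t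
        - (Dt (Dy u) x y t * Dx (Dx u) x y t + Dy u x y t * Dt (Dx (Dx u)) x y t) := by
  have h : Dt (Dy u) = fun x y t =>
      Dx u x y t * Dx (Dy u) x y t - Dy u x y t * Dx (Dx u) x y t := by
    funext x y t
    exact husol x y t
  exact (congrArg (fun f => Dt f x y t) h).trans
    (((hu.Dx.hasDerivAt_t x y t).mul (hu.Dy.Dx.hasDerivAt_t x y t)).sub
    ((hu.Dy.hasDerivAt_t x y t).mul (hu.Dx.Dx.hasDerivAt_t x y t))).deriv

/-- The scaling symmetry. -/
theorem linRdDym_scaling {u : ℝ → ℝ → ℝ → ℝ} (hu : Smooth3 u)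
    (husol : ∀ x y t : ℝ,
      Dt (Dy u) x y t = Dx u x y t * Dx (Dy u) x y t - Dy u x y t * Dx (Dx u) x y t)
    (x y t : ℝ) : linRdDym u (fun x y t => -x * Dx u x y t + 2 * u x y t) x y t = 0 := by
  have hx : Dx (fun x y t => -x * Dx u x y t + 2 * u x y t) = fun x y t =>
      Dx u x y t - x * Dx (Dx u) x y t := by
    funext x y t
    refine HasDerivAt.deriv (HasDerivAt.congr_deriv
      (((hasDerivAt_id' x).fun_neg.mul (hu.Dx.hasDerivAt_x x y t)).add
        ((hu.hasDerivAt_x x y t).const_mul 2)) ?_)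
    ring
  have hy : Dy (fun x y t => -x * Dx u x y t + 2 * u x y t) = fun x y t =>
      -x * Dy (Dx u) x y t + 2 * Dy u x y t := by
    funext x y t
    refine HasDerivAt.deriv (HasDerivAt.congr_deriv
      (((hu.Dx.hasDerivAt_y x y t).const_mul (-x)).add ((hu.hasDerivAt_y x y t).const_mul 2)) ?_)
    ring
  have hxx : Dx (fun x y t =>
      Dx u x y t - x * Dx (Dx u) x y t) = fun x y t =>
      -x * Dx (Dx (Dx u)) x y t := by
    funext x y t
    refine HasDerivAt.deriv (HasDerivAt.congr_deriv
      ((hu.Dx.hasDerivAt_x x y t).sub ((hasDerivAt_id' x).mul (hu.Dx.Dx.hasDerivAt_x x y t))) ?_)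
    ring
  have hxy : Dx (fun x y t =>
      -x * Dy (Dx u) x y t + 2 * Dy u x y t) = fun x y t =>
      Dx (Dy u) x y t * 2 - Dy (Dx u) x y t - x * Dx (Dy (Dx u)) x y t := by
    funext x y t
    refine HasDerivAt.deriv (HasDerivAt.congr_deriv
      (((hasDerivAt_id' x).fun_neg.mul (hu.Dx.Dy.hasDerivAt_x x y t)).add
        ((hu.Dy.hasDerivAt_x x y t).const_mul 2)) ?_)
    ring
  have hyt : Dt (fun x y t =>
      -x * Dy (Dx u) x y t + 2 * Dy u x y t) = fun x y t =>
      -x * Dt (Dy (Dx u)) x y t + 2 * Dt (Dy u) x y t := by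
    funext x y t
    refine HasDerivAt.deriv (HasDerivAt.congr_deriv
      (((hu.Dx.Dy.hasDerivAt_t x y t).const_mul (-x)).add ((hu.Dy.hasDerivAt_t x y t).const_mul 2)) ?_)
    ring
  simp only [linRdDym, hx, hy, hxx, hxy, hyt]
  have e := husol x y t
  have e₁ := rdDym_Dx hu husol x y t
  simp only [hu.Dy_Dx, hu.Dt_Dy, hu.Dy.Dt_Dx] at e e₁ ⊢
  linear_combination 2 * e - x * e₁

/-- The symmetry generated by a change of the variable `y`. -/
theorem linRdDym_y_reparametrization {u : ℝ → ℝ → ℝ → ℝ} (hu : Smooth3 u)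
    (husol : ∀ x y t : ℝ,
      Dt (Dy u) x y t = Dx u x y t * Dx (Dy u) x y t - Dy u x y t * Dx (Dx u) x y t)
    {Y : ℝ → ℝ} (hY : ContDiff ℝ (⊤ : ℕ∞) Y)
    (x y t : ℝ) : linRdDym u (fun x y t => Y y * Dy u x y t) x y t = 0 := by
  have dY : ∀ y, HasDerivAt Y (deriv Y y) y := fun y =>
    (hY.differentiable (by simp) y).hasDerivAt
  have hx : Dx (fun x y t => Y y * Dy u x y t) = fun x y t =>
      Y y * Dx (Dy u) x y t := by
    funext x y t
    refine HasDerivAt.deriv (HasDerivAt.congr_deriv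
      ((hu.Dy.hasDerivAt_x x y t).const_mul (Y y)) ?_)
    ring
  have hy : Dy (fun x y t => Y y * Dy u x y t) = fun x y t =>
      deriv Y y * Dy u x y t + Y y * Dy (Dy u) x y t := by
    funext x y t
    refine HasDerivAt.deriv (HasDerivAt.congr_deriv
      ((dY y).mul (hu.Dy.hasDerivAt_y x y t)) ?_)
    ring
  have hxx : Dx (fun x y t =>
      Y y * Dx (Dy u) x y t) = fun x y t =>
      Y y * Dx (Dx (Dy u)) x y t := by
    funext x y t
    refine HasDerivAt.deriv (HasDerivAt.congr_deriv
      ((hu.Dy.Dx.hasDerivAt_x x y t).const_mul (Y y)) ?_)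
    ring
  have hxy : Dx (fun x y t =>
      deriv Y y * Dy u x y t + Y y * Dy (Dy u) x y t) = fun x y t =>
      deriv Y y * Dx (Dy u) x y t + Y y * Dx (Dy (Dy u)) x y t := by
    funext x y t
    refine HasDerivAt.deriv (HasDerivAt.congr_deriv
      (((hu.Dy.hasDerivAt_x x y t).const_mul (deriv Y y)).add
        ((hu.Dy.Dy.hasDerivAt_x x y t).const_mul (Y y))) ?_)
    ring
  have hyt : Dt (fun x y t =>
      deriv Y y * Dy u x y t + Y y * Dy (Dy u) x y t) = fun x y t =>
      deriv Y y * Dt (Dy u) x y t + Y y * Dt (Dy (Dy u)) x y t := by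
    funext x y t
    refine HasDerivAt.deriv (HasDerivAt.congr_deriv
      (((hu.Dy.hasDerivAt_t x y t).const_mul (deriv Y y)).add
        ((hu.Dy.Dy.hasDerivAt_t x y t).const_mul (Y y))) ?_)
    ring
  simp only [linRdDym, hx, hy, hxx, hxy, hyt]
  have e := husol x y t
  have e₂ := rdDym_Dy hu husol x y t
  simp only [hu.Dy_Dx, hu.Dt_Dy, hu.Dx.Dy_Dx, hu.Dy.Dy_Dx, hu.Dy.Dt_Dy] at e e₂ ⊢
  linear_combination Y y * e₂ + deriv Y y * e

/-- The symmetry generated by a change of the variable `t`. -/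
theorem linRdDym_t_reparametrization {u : ℝ → ℝ → ℝ → ℝ} (hu : Smooth3 u)
    (husol : ∀ x y t : ℝ,
      Dt (Dy u) x y t = Dx u x y t * Dx (Dy u) x y t - Dy u x y t * Dx (Dx u) x y t)
    {T : ℝ → ℝ} (hT : ContDiff ℝ (⊤ : ℕ∞) T)
    (x y t : ℝ) : linRdDym u (fun x y t =>
        T t * Dt u x y t + deriv T t * (x * Dx u x y t - u x y t)
          + (1 / 2) * deriv (deriv T) t * x ^ 2) x y t = 0 := by
  have hT' : ContDiff ℝ (⊤ : ℕ∞) (deriv T) := (contDiff_infty_iff_deriv.mp hT).2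
  have dT : ∀ t, HasDerivAt T (deriv T t) t := fun t =>
    (hT.differentiable (by simp) t).hasDerivAt
  have dT' : ∀ t, HasDerivAt (deriv T) (deriv (deriv T) t) t := fun t =>
    (hT'.differentiable (by simp) t).hasDerivAt
  have hx : Dx (fun x y t =>
        T t * Dt u x y t + deriv T t * (x * Dx u x y t - u x y t)
          + (1 / 2) * deriv (deriv T) t * x ^ 2) = fun x y t =>
      T t * Dx (Dt u) x y t + deriv T t * (x * Dx (Dx u) x y t) + deriv (deriv T) t * x := by
    funext x y t
    refine HasDerivAt.deriv (HasDerivAt.congr_deriv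
      (((hu.Dt.hasDerivAt_x x y t).const_mul (T t)).add
        ((((hasDerivAt_id' x).mul (hu.Dx.hasDerivAt_x x y t)).sub (hu.hasDerivAt_x x y t)).const_mul (deriv T t))
        |>.add (((hasDerivAt_id' x).pow 2).const_mul ((1 / 2) * deriv (deriv T) t))) ?_)
    ring
  have hy : Dy (fun x y t =>
        T t * Dt u x y t + deriv T t * (x * Dx u x y t - u x y t)
          + (1 / 2) * deriv (deriv T) t * x ^ 2) = fun x y t =>
      T t * Dy (Dt u) x y t + deriv T t * (x * Dy (Dx u) x y t - Dy u x y t) := by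
    funext x y t
    refine HasDerivAt.deriv (HasDerivAt.congr_deriv
      (((hu.Dt.hasDerivAt_y x y t).const_mul (T t)).add
        ((((hu.Dx.hasDerivAt_y x y t).const_mul x).sub (hu.hasDerivAt_y x y t)).const_mul (deriv T t))
        |>.add_const ((1 / 2) * deriv (deriv T) t * x ^ 2)) ?_)
    ring
  have hxx : Dx (fun x y t =>
      T t * Dx (Dt u) x y t + deriv T t * (x * Dx (Dx u) x y t)
        + deriv (deriv T) t * x) = fun x y t =>
      T t * Dx (Dx (Dt u)) x y t + deriv T t * (Dx (Dx u) x y t + x * Dx (Dx (Dx u)) x y t)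
        + deriv (deriv T) t := by
    funext x y t
    refine HasDerivAt.deriv (HasDerivAt.congr_deriv
      (((hu.Dt.Dx.hasDerivAt_x x y t).const_mul (T t)).add
        (((hasDerivAt_id' x).mul (hu.Dx.Dx.hasDerivAt_x x y t)).const_mul (deriv T t))
        |>.add ((hasDerivAt_id' x).const_mul (deriv (deriv T) t))) ?_)
    ring
  have hxy : Dx (fun x y t =>
      T t * Dy (Dt u) x y t + deriv T t * (x * Dy (Dx u) x y t - Dy u x y t)) = fun x y t =>
      T t * Dx (Dy (Dt u)) x y t + deriv T t * (Dy (Dx u) x y t + x * Dx (Dy (Dx u)) x y t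
        - Dx (Dy u) x y t) := by
    funext x y t
    refine HasDerivAt.deriv (HasDerivAt.congr_deriv
      (((hu.Dt.Dy.hasDerivAt_x x y t).const_mul (T t)).add
        ((((hasDerivAt_id' x).mul (hu.Dx.Dy.hasDerivAt_x x y t)).sub (hu.Dy.hasDerivAt_x x y t)).const_mul
          (deriv T t))) ?_)
    ring
  have hyt : Dt (fun x y t =>
      T t * Dy (Dt u) x y t + deriv T t * (x * Dy (Dx u) x y t - Dy u x y t)) = fun x y t =>
      deriv T t * Dy (Dt u) x y t + T t * Dt (Dy (Dt u)) x y t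
        + deriv (deriv T) t * (x * Dy (Dx u) x y t - Dy u x y t)
        + deriv T t * (x * Dt (Dy (Dx u)) x y t - Dt (Dy u) x y t) := by
    funext x y t
    refine HasDerivAt.deriv (HasDerivAt.congr_deriv
      (((dT t).mul (hu.Dt.Dy.hasDerivAt_t x y t)).add
        ((dT' t).mul (((hu.Dx.Dy.hasDerivAt_t x y t).const_mul x).sub (hu.Dy.hasDerivAt_t x y t)))) ?_)
    ring
  simp only [linRdDym, hx, hy, hxx, hxy, hyt]
  have e₁ := rdDym_Dx hu husol x y t
  have e₃ := rdDym_Dt hu husol x y t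
  simp only [hu.Dy_Dx, hu.Dt_Dx, hu.Dt_Dy, hu.Dx.Dt_Dx, hu.Dy.Dt_Dx, hu.Dt.Dt_Dy] at e₁ e₃ ⊢
  linear_combination T t * e₃ + deriv T t * x * e₁

/-- The symmetry generated by `t`-dependent translations of the variable `x`. -/
theorem linRdDym_x_translation {u : ℝ → ℝ → ℝ → ℝ} (hu : Smooth3 u)
    (husol : ∀ x y t : ℝ,
      Dt (Dy u) x y t = Dx u x y t * Dx (Dy u) x y t - Dy u x y t * Dx (Dx u) x y t)
    {T : ℝ → ℝ} (hT : ContDiff ℝ (⊤ : ℕ∞) T)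
    (x y t : ℝ) : linRdDym u (fun x y t => T t * Dx u x y t + deriv T t * x) x y t = 0 := by
  have dT : ∀ t, HasDerivAt T (deriv T t) t := fun t =>
    (hT.differentiable (by simp) t).hasDerivAt
  have hx : Dx (fun x y t => T t * Dx u x y t + deriv T t * x) = fun x y t =>
      T t * Dx (Dx u) x y t + deriv T t := by
    funext x y t
    refine HasDerivAt.deriv (HasDerivAt.congr_deriv
      (((hu.Dx.hasDerivAt_x x y t).const_mul (T t)).add
        ((hasDerivAt_id' x).const_mul (deriv T t))) ?_)
    ring
  have hy : Dy (fun x y t => T t * Dx u x y t + deriv T t * x) = fun x y t =>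
      T t * Dy (Dx u) x y t := by
    funext x y t
    refine HasDerivAt.deriv (HasDerivAt.congr_deriv
      (((hu.Dx.hasDerivAt_y x y t).const_mul (T t)).add_const (deriv T t * x)) ?_)
    ring
  have hxx : Dx (fun x y t =>
      T t * Dx (Dx u) x y t + deriv T t) = fun x y t =>
      T t * Dx (Dx (Dx u)) x y t := by
    funext x y t
    refine HasDerivAt.deriv (HasDerivAt.congr_deriv
      (((hu.Dx.Dx.hasDerivAt_x x y t).const_mul (T t)).add_const (deriv T t)) ?_)
    ring
  have hxy : Dx (fun x y t =>
      T t * Dy (Dx u) x y t) = fun x y t =>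
      T t * Dx (Dy (Dx u)) x y t := by
    funext x y t
    refine HasDerivAt.deriv (HasDerivAt.congr_deriv
      ((hu.Dx.Dy.hasDerivAt_x x y t).const_mul (T t)) ?_)
    ring
  have hyt : Dt (fun x y t =>
      T t * Dy (Dx u) x y t) = fun x y t =>
      deriv T t * Dy (Dx u) x y t + T t * Dt (Dy (Dx u)) x y t := by
    funext x y t
    refine HasDerivAt.deriv (HasDerivAt.congr_deriv
      ((dT t).mul (hu.Dx.Dy.hasDerivAt_t x y t)) ?_)
    ring
  simp only [linRdDym, hx, hy, hxx, hxy, hyt]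
  have e₁ := rdDym_Dx hu husol x y t
  simp only [hu.Dy_Dx, hu.Dt_Dy, hu.Dy.Dt_Dx] at e₁ ⊢
  linear_combination T t * e₁

/-- Functions of `t` alone are symmetries. -/
theorem linRdDym_function_of_t (u : ℝ → ℝ → ℝ → ℝ) (T : ℝ → ℝ) (x y t : ℝ) :
    linRdDym u (fun _ _ t => T t) x y t = 0 := by
  simp [linRdDym, Dx, Dy, Dt]

/-- Local symmetries of the rdDym equation. -/
theorem rdDym_local_symmetries
    (u : ℝ → ℝ → ℝ → ℝ) (hu : Smooth3 u)
    (husol : ∀ x y t : ℝ, Dt (Dy u) x y t = Dx u x y t * Dx (Dy u) x y t - Dy u x y t * Dx (Dx u) x y t)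
    (T Y : ℝ → ℝ) (hT : ContDiff ℝ (⊤ : ℕ∞) T) (hY : ContDiff ℝ (⊤ : ℕ∞) Y) :
    (∀ x y t : ℝ,
      linRdDym u (fun x y t => -x * Dx u x y t + 2 * u x y t) x y t = 0) ∧
    (∀ x y t : ℝ,
      linRdDym u (fun x y t => Y y * Dy u x y t) x y t = 0) ∧
    (∀ x y t : ℝ,
      linRdDym u (fun x y t =>
        T t * Dt u x y t + deriv T t * (x * Dx u x y t - u x y t)
          + (1 / 2) * deriv (deriv T) t * x ^ 2) x y t = 0) ∧
    (∀ x y t : ℝ,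
      linRdDym u (fun x y t => T t * Dx u x y t + deriv T t * x) x y t = 0) ∧
    (∀ x y t : ℝ,
      linRdDym u (fun x y t => T t) x y t = 0) := by
  exact ⟨linRdDym_scaling hu husol, linRdDym_y_reparametrization hu husol hY,
    linRdDym_t_reparametrization hu husol hT, linRdDym_x_translation hu husol hT,
    linRdDym_function_of_t u T⟩
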